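/- The symmetric configuration cannot be realised by circles. Precisely: there do not exist real numbers r₁, …, r₈ > 0 and t₁ < t₂ < ⋯ < t₈ such that, letting Cᵢ for i ∈ {2, 3, 6, 7} be the circle with center (tᵢ, rᵢ) and radius rᵢ (tangent to the x-axis from above at (tᵢ,0)) and Cᵢ for i ∈ {1, 4, 5, 8} be the circle with center (tᵢ, −rᵢ) and radius rᵢ (tangent to the x-axis from below at (tᵢ,0)), the pairs (C₂, C₃), (C₃, C₆), (C₆, C₇), (C₂, C₇) are each externally tangent and the pairs (C₁, C₄), (C₄, C₅), (C₅, C₈), (C₁, C₈) are each externally tangent (distance between centers equals the sum of the radii in each case). -/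

import Mathlib

/-- The point `(x, y)` in the Euclidean plane `ℝ²` (with the Euclidean distance). -/
noncomputable def pt (x y : ℝ) : EuclideanSpace ℝ (Fin 2) :=
  (WithLp.equiv 2 (Fin 2 → ℝ)).symm ![x, y]

lemma tangent_sq {a b r s : ℝ} (h : dist (pt a r) (pt b s) = |r| + |s|) :
    (b - a) ^ 2 = 2 * (|r| * |s| + r * s) := by
  have h2 : (dist (pt a r) (pt b s)) ^ 2 = (a - b) ^ 2 + (r - s) ^ 2 := by
    rw [EuclideanSpace.dist_eq, Real.sq_sqrt (by positivity)]
    simp [pt, Fin.sum_univ_two, Real.dist_eq, sq_abs]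
  rw [h] at h2
  nlinarith [sq_abs r, sq_abs s]

/-- The cross-ratio identity for a cyclic chain of four tangent circles. -/
lemma cross_ratio {p q u v a b c d : ℝ} (ha : 0 < a) (hb : 0 < b) (hc : 0 < c) (hd : 0 < d)
    (h1 : p < q) (h2 : q < u) (h3 : u < v)
    (e1 : (q - p) ^ 2 = 4 * (a * b)) (e2 : (u - q) ^ 2 = 4 * (b * c))
    (e3 : (v - u) ^ 2 = 4 * (c * d)) (e4 : (v - p) ^ 2 = 4 * (a * d)) :
    (u - q) / (q - p) + (u - q) / (v - u) + (u - q) / (q - p) * ((u - q) / (v - u)) = 1 := by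
  have hx : 0 < q - p := by linarith
  have hy : 0 < u - q := by linarith
  have hz : 0 < v - u := by linarith
  have hw : 0 < v - p := by linarith
  have key : (q - p) * (v - u) = (u - q) * (v - p) := by
    have : ((q - p) * (v - u)) ^ 2 = ((u - q) * (v - p)) ^ 2 := by
      rw [mul_pow, mul_pow, e1, e2, e3, e4]; ring
    exact (pow_left_inj₀ (by positivity) (by positivity) two_ne_zero).1 this
  field_simp
  linarith

/-- Lemma 3 (symmetric configuration): there is no family of eight circles tangent to the
x-axis at `t₁ < ⋯ < t₈`, circles `2, 3, 6, 7` above the axis and `1, 4, 5, 8` below,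
such that the pairs `(2,3), (3,6), (6,7), (2,7)` and `(1,4), (4,5), (5,8), (1,8)` are
all externally tangent. -/
theorem symmetric_configuration_impossible :
    ¬ ∃ r₁ r₂ r₃ r₄ r₅ r₆ r₇ r₈ t₁ t₂ t₃ t₄ t₅ t₆ t₇ t₈ : ℝ,
      0 < r₁ ∧ 0 < r₂ ∧ 0 < r₃ ∧ 0 < r₄ ∧ 0 < r₅ ∧ 0 < r₆ ∧ 0 < r₇ ∧ 0 < r₈ ∧
      t₁ < t₂ ∧ t₂ < t₃ ∧ t₃ < t₄ ∧ t₄ < t₅ ∧ t₅ < t₆ ∧ t₆ < t₇ ∧ t₇ < t₈ ∧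
      dist (pt t₂ r₂) (pt t₃ r₃) = r₂ + r₃ ∧
      dist (pt t₃ r₃) (pt t₆ r₆) = r₃ + r₆ ∧
      dist (pt t₆ r₆) (pt t₇ r₇) = r₆ + r₇ ∧
      dist (pt t₂ r₂) (pt t₇ r₇) = r₂ + r₇ ∧
      dist (pt t₁ (-r₁)) (pt t₄ (-r₄)) = r₁ + r₄ ∧
      dist (pt t₄ (-r₄)) (pt t₅ (-r₅)) = r₄ + r₅ ∧
      dist (pt t₅ (-r₅)) (pt t₈ (-r₈)) = r₅ + r₈ ∧
      dist (pt t₁ (-r₁)) (pt t₈ (-r₈)) = r₁ + r₈ := by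
  rintro ⟨r₁, r₂, r₃, r₄, r₅, r₆, r₇, r₈, t₁, t₂, t₃, t₄, t₅, t₆, t₇, t₈,
    p1, p2, p3, p4, p5, p6, p7, p8, l1, l2, l3, l4, l5, l6, l7,
    e1, e2, e3, e4, f1, f2, f3, f4⟩
  have up : ∀ {a b r s : ℝ}, 0 < r → 0 < s → dist (pt a r) (pt b s) = r + s →
      (b - a) ^ 2 = 4 * (r * s) := by
    intro a b r s hr hs h
    have := tangent_sq (a := a) (b := b) (r := r) (s := s)
      (by rw [h, abs_of_pos hr, abs_of_pos hs])
    rw [abs_of_pos hr, abs_of_pos hs] at this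
    linarith
  have dn : ∀ {a b r s : ℝ}, 0 < r → 0 < s → dist (pt a (-r)) (pt b (-s)) = r + s →
      (b - a) ^ 2 = 4 * (r * s) := by
    intro a b r s hr hs h
    have := tangent_sq (a := a) (b := b) (r := -r) (s := -s)
      (by rw [h, abs_neg, abs_neg, abs_of_pos hr, abs_of_pos hs])
    rw [abs_neg, abs_neg, abs_of_pos hr, abs_of_pos hs] at this
    linarith
  have A := cross_ratio p2 p3 p6 p7 l2 (by linarith) l6
    (up p2 p3 e1) (up p3 p6 e2) (up p6 p7 e3) (up p2 p7 e4)
  have B := cross_ratio p1 p4 p5 p8 (by linarith) l4 (by linarith)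
    (dn p1 p4 f1) (dn p4 p5 f2) (dn p5 p8 f3) (dn p1 p8 f4)
  have c1 : (t₅ - t₄) / (t₄ - t₁) < (t₆ - t₃) / (t₃ - t₂) :=
    div_lt_div₀ (by linarith) (by linarith) (by linarith) (by linarith)
  have c2 : (t₅ - t₄) / (t₈ - t₅) < (t₆ - t₃) / (t₇ - t₆) :=
    div_lt_div₀ (by linarith) (by linarith) (by linarith) (by linarith)
  have d1 : 0 < (t₅ - t₄) / (t₄ - t₁) := div_pos (by linarith) (by linarith)
  have d2 : 0 < (t₅ - t₄) / (t₈ - t₅) := div_pos (by linarith) (by linarith)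
  have c3 := mul_lt_mul'' c1 c2 d1.le d2.le
  linarith
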